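/- arXiv:1811.08493 — 2 statements merged into one kernel-verified Lean document; each statement's English description precedes it below -/
import Mathlib

section
/- Let A be a G₁-matrix with lim_{i→∞} a_n(i) = 0 for every n. Then the following are equivalent: (1) the inverse Cesàro map y ↦ (i·y_i − (i−1)·y_{i−1})_i (with y_0 := 0) maps λ₀(A) into itself and for every n there exist m and M > 0 with p_n(C⁻¹ y) ≤ M·p_m(y) for all y ∈ λ₀(A) (equivalently, 0 does not belong to the spectrum of C on λ₀(A)); (2) there exists a nonzero x ∈ λ₀(A) with C x = (1/2)·x; (3) there exists an integer s ≥ 2 and a nonzero x ∈ λ₀(A) with C x = (1/s)·x; (4) for every integer s ≥ 1 there exists a nonzero x ∈ λ₀(A) with C x = (1/s)·x. -/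
open Filter Finset Topology

noncomputable section

/-- A Köthe matrix: entries are nonnegative, increasing in `n`, and for each column some
entry is positive.  (Index `i : ℕ` corresponds to the index `i + 1` of the paper.) -/
def KotheMatrix (a : ℕ → ℕ → ℝ) : Prop :=
  (∀ n i, 0 ≤ a n i ∧ a n i ≤ a (n + 1) i) ∧ ∀ i, ∃ n, 0 < a n i

/-- Condition (G1-1): `0 < a_n(i+1) ≤ a_n(i)`. -/
def G11 (a : ℕ → ℕ → ℝ) : Prop :=
  ∀ n i, 0 < a n (i + 1) ∧ a n (i + 1) ≤ a n i

/-- Condition (G1-2). -/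
def G12 (a : ℕ → ℕ → ℝ) : Prop :=
  ∀ n, ∃ m > n, ∃ C > 0, ∀ i, a n i ≤ C * a m i ^ 2

/-- Membership in the Köthe echelon space of order zero `λ₀(A)`. -/
def inLambda0 (a : ℕ → ℕ → ℝ) (x : ℕ → ℂ) : Prop :=
  ∀ n, Tendsto (fun i => a n i * ‖x i‖) atTop (𝓝 0)

/-- The canonical seminorms `p_n(x) = sup_i a_n(i) |x_i|` of `λ₀(A)`. -/
def pnorm (a : ℕ → ℕ → ℝ) (n : ℕ) (x : ℕ → ℂ) : ℝ :=
  ⨆ i, a n i * ‖x i‖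

/-- The discrete Cesàro operator, `(C x)_i = (x_1 + ⋯ + x_i) / i` (indices shifted by one). -/
def cesaro (x : ℕ → ℂ) : ℕ → ℂ :=
  fun i => (∑ j ∈ Finset.range (i + 1), x j) / ((i : ℂ) + 1)

/-- The inverse Cesàro map `(C⁻¹ y)_i = i·y_i − (i−1)·y_{i−1}` (indices shifted by one). -/
def icesaro (y : ℕ → ℂ) : ℕ → ℂ := fun i => ((i : ℂ) + 1) * y i - (i : ℂ) * y (i - 1)

/-- The weights of `A` decay faster than the `k`-th power of the index. -/
def DecaysPow (a : ℕ → ℕ → ℝ) (k : ℕ) : Prop :=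
  ∀ n, Tendsto (fun i : ℕ => a n i * ((i : ℝ) + 1) ^ k) atTop (𝓝 0)

theorem inLambda0.bddAbove {a : ℕ → ℕ → ℝ} {x : ℕ → ℂ} (hx : inLambda0 a x) (n : ℕ) :
    BddAbove (Set.range fun i => a n i * ‖x i‖) :=
  (hx n).bddAbove_range

theorem inLambda0.le_pnorm {a : ℕ → ℕ → ℝ} {x : ℕ → ℂ} (hx : inLambda0 a x) (n i : ℕ) :
    a n i * ‖x i‖ ≤ pnorm a n x :=
  le_ciSup (hx.bddAbove n) i

theorem inLambda0_single (a : ℕ → ℕ → ℝ) (k : ℕ) :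
    inLambda0 a (Pi.single k (1 : ℂ)) := by
  intro n
  refine tendsto_const_nhds.congr' ?_
  filter_upwards [eventually_gt_atTop k] with i hi
  simp [Pi.single_eq_of_ne hi.ne']

theorem pnorm_single_le {a : ℕ → ℕ → ℝ} (h0 : ∀ n i, 0 ≤ a n i) (n k : ℕ) :
    pnorm a n (Pi.single k (1 : ℂ)) ≤ a n k := by
  refine ciSup_le fun i => ?_
  rcases eq_or_ne i k with rfl | hi
  · simp
  · simpa [Pi.single_eq_of_ne hi] using h0 n k

theorem sum_range_choose_eq (i k : ℕ) :
    ∑ j ∈ Finset.range i, j.choose k = i.choose (k + 1) := by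
  induction i with
  | zero => simp
  | succ i ih => rw [Finset.sum_range_succ, ih, Nat.choose_succ_succ, add_comm]

theorem succ_le_choose_add (i k : ℕ) : i + 1 ≤ i.choose (k + 1) + (k + 1) := by
  induction i with
  | zero => omega
  | succ i ih =>
    rw [Nat.choose_succ_succ']
    rcases le_or_gt k i with h | h
    · have := Nat.choose_pos h
      omega
    · omega

theorem cesaro_choose (k i : ℕ) :
    cesaro (fun j => (j.choose k : ℂ)) i = (1 / ((k + 1 : ℕ) : ℂ)) * (i.choose k : ℂ) := by
  have hi : (i : ℂ) + 1 ≠ 0 := by exact_mod_cast Nat.succ_ne_zero i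
  have hk : ((k + 1 : ℕ) : ℂ) ≠ 0 := by exact_mod_cast Nat.succ_ne_zero k
  have h : ((i : ℂ) + 1) * (i.choose k : ℂ)
      = ((i + 1).choose (k + 1) : ℂ) * ((k + 1 : ℕ) : ℂ) := by
    exact_mod_cast Nat.add_one_mul_choose_eq i k
  rw [cesaro, ← Nat.cast_sum, sum_range_choose_eq, div_eq_iff hi]
  field_simp
  linear_combination -h

/-- Eigenvectors of the Cesàro operator for `1 / (k + 1)` are multiples of the binomial
sequence `i ↦ i.choose k`. -/
theorem eq_mul_choose_of_cesaro_eq {x : ℕ → ℂ} {k : ℕ}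
    (hx : ∀ i, cesaro x i = (1 / ((k + 1 : ℕ) : ℂ)) * x i) (i : ℕ) :
    x i = x k * (i.choose k : ℂ) := by
  induction i using Nat.strong_induction_on with
  | _ i ih =>
    rcases eq_or_ne i k with rfl | hik
    · simp
    have hi : (i : ℂ) + 1 ≠ 0 := by exact_mod_cast Nat.succ_ne_zero i
    have hk : (k : ℂ) + 1 ≠ 0 := by exact_mod_cast Nat.succ_ne_zero k
    have hsum : ∑ j ∈ Finset.range i, x j = x k * (i.choose (k + 1) : ℂ) := by
      rw [Finset.sum_congr rfl fun j hj => ih j (Finset.mem_range.mp hj), ← Finset.mul_sum,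
        ← Nat.cast_sum, sum_range_choose_eq]
    have h := hx i
    rw [cesaro, Finset.sum_range_succ, hsum, div_eq_iff hi] at h
    push_cast at h
    field_simp at h
    have hc : (i.choose (k + 1) : ℂ) * ((k : ℂ) + 1) = (i.choose k : ℂ) * ((i : ℂ) - k) := by
      rcases le_or_gt k i with hle | hlt
      · have := Nat.choose_succ_right_eq i k
        rw [← Nat.cast_sub hle]
        exact_mod_cast this
      · simp [Nat.choose_eq_zero_of_lt hlt, Nat.choose_eq_zero_of_lt (hlt.trans k.lt_succ_self)]
    have hne : (i : ℂ) - k ≠ 0 := sub_ne_zero.mpr (by exact_mod_cast hik)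
    refine mul_left_cancel₀ hne ?_
    linear_combination -h + x k * hc

theorem DecaysPow.mono {a : ℕ → ℕ → ℝ} (h0 : ∀ n i, 0 ≤ a n i) {j k : ℕ} (hjk : j ≤ k)
    (h : DecaysPow a k) : DecaysPow a j := by
  intro n
  refine squeeze_zero (fun i => mul_nonneg (h0 n i) (by positivity)) (fun i => ?_) (h n)
  exact mul_le_mul_of_nonneg_left
    (pow_le_pow_right₀ (le_add_of_nonneg_left i.cast_nonneg) hjk) (h0 n i)

theorem DecaysPow.double {a : ℕ → ℕ → ℝ} (h0 : ∀ n i, 0 ≤ a n i) (hG2 : G12 a) {k : ℕ}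
    (h : DecaysPow a k) : DecaysPow a (2 * k) := by
  intro n
  obtain ⟨m, -, C, -, hm⟩ := hG2 n
  have hlim := ((h m).pow 2).const_mul C
  rw [zero_pow two_ne_zero, mul_zero] at hlim
  refine squeeze_zero (fun i => mul_nonneg (h0 n i) (by positivity)) (fun i => ?_) hlim
  calc a n i * ((i : ℝ) + 1) ^ (2 * k)
      ≤ C * a m i ^ 2 * ((i : ℝ) + 1) ^ (2 * k) :=
        mul_le_mul_of_nonneg_right (hm i) (by positivity)
    _ = C * (a m i * ((i : ℝ) + 1) ^ k) ^ 2 := by ring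

theorem DecaysPow.all {a : ℕ → ℕ → ℝ} (h0 : ∀ n i, 0 ≤ a n i) (hG2 : G12 a)
    (h : DecaysPow a 1) (k : ℕ) : DecaysPow a k := by
  refine DecaysPow.mono h0 k.le_succ ?_
  induction k with
  | zero => exact h
  | succ k ih => exact DecaysPow.mono h0 (by omega) (ih.double h0 hG2)

theorem DecaysPow.inLambda0_choose {a : ℕ → ℕ → ℝ} (h0 : ∀ n i, 0 ≤ a n i) {k : ℕ}
    (h : DecaysPow a k) : inLambda0 a fun i => (i.choose k : ℂ) := by
  intro n
  refine squeeze_zero (fun i => mul_nonneg (h0 n i) (norm_nonneg _)) (fun i => ?_) (h n)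
  refine mul_le_mul_of_nonneg_left ?_ (h0 n i)
  rw [Complex.norm_natCast]
  calc (i.choose k : ℝ) ≤ (i : ℝ) ^ k := by exact_mod_cast Nat.choose_le_pow i k
    _ ≤ ((i : ℝ) + 1) ^ k := by gcongr; linarith

theorem DecaysPow.of_eigenvector {a : ℕ → ℕ → ℝ} (h0 : ∀ n i, 0 ≤ a n i)
    (hvanish : ∀ n, Tendsto (fun i => a n i) atTop (𝓝 0)) {x : ℕ → ℂ} {k : ℕ}
    (hx : inLambda0 a x) (hx0 : x ≠ 0)
    (hev : ∀ i, cesaro x i = (1 / ((k + 1 + 1 : ℕ) : ℂ)) * x i) : DecaysPow a 1 := by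
  have hform := eq_mul_choose_of_cesaro_eq hev
  have hc : ‖x (k + 1)‖ ≠ 0 := by
    rw [norm_ne_zero_iff]
    intro hc
    exact hx0 (funext fun i => by rw [hform i, hc, zero_mul, Pi.zero_apply])
  intro n
  have hlim := ((hx n).const_mul ‖x (k + 1)‖⁻¹).add ((hvanish n).mul_const ((k : ℝ) + 1))
  rw [mul_zero, zero_mul, add_zero] at hlim
  refine squeeze_zero (fun i => mul_nonneg (h0 n i) (by positivity)) (fun i => ?_) hlim
  have hle : (i : ℝ) + 1 ≤ (i.choose (k + 1) : ℝ) + (k + 1) := by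
    exact_mod_cast succ_le_choose_add i k
  have hnorm : ‖x (k + 1)‖⁻¹ * (a n i * ‖x i‖) = a n i * (i.choose (k + 1) : ℝ) := by
    rw [hform i, norm_mul, Complex.norm_natCast]
    field_simp
  rw [hnorm, pow_one, ← mul_add]
  exact mul_le_mul_of_nonneg_left hle (h0 n i)

theorem DecaysPow.of_icesaro {a : ℕ → ℕ → ℝ} (h0 : ∀ n i, 0 ≤ a n i)
    (hvanish : ∀ n, Tendsto (fun i => a n i) atTop (𝓝 0))
    (hmap : ∀ y : ℕ → ℂ, inLambda0 a y → inLambda0 a (icesaro y))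
    (hcont : ∀ n : ℕ, ∃ m : ℕ, ∃ M > (0 : ℝ),
      ∀ y : ℕ → ℂ, inLambda0 a y → pnorm a n (icesaro y) ≤ M * pnorm a m y) :
    DecaysPow a 1 := by
  intro n
  obtain ⟨m, M, hM, hb⟩ := hcont n
  have hlim := (hvanish m).const_mul M
  rw [mul_zero] at hlim
  refine squeeze_zero (fun i => mul_nonneg (h0 n i) (by positivity)) (fun k => ?_) hlim
  have hval : ‖icesaro (Pi.single k (1 : ℂ)) k‖ = (k : ℝ) + 1 := by
    have hz : (k : ℂ) * (Pi.single k (1 : ℂ) : ℕ → ℂ) (k - 1) = 0 := by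
      rcases k with _ | k
      · simp
      · simp
    rw [icesaro, hz, Pi.single_eq_same, mul_one, sub_zero]
    exact_mod_cast Complex.norm_natCast (k + 1)
  have hs := inLambda0_single a k
  calc a n k * ((k : ℝ) + 1) ^ 1 = a n k * ‖icesaro (Pi.single k (1 : ℂ)) k‖ := by
        rw [hval, pow_one]
    _ ≤ pnorm a n (icesaro (Pi.single k (1 : ℂ))) := (hmap _ hs).le_pnorm n k
    _ ≤ M * pnorm a m (Pi.single k (1 : ℂ)) := hb _ hs
    _ ≤ M * a m k := mul_le_mul_of_nonneg_left (pnorm_single_le h0 m k) hM.le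

theorem DecaysPow.exists_mul_le {a : ℕ → ℕ → ℝ} (h0 : ∀ n i, 0 ≤ a n i) (hG2 : G12 a)
    (h : DecaysPow a 1) (n : ℕ) :
    ∃ m, ∃ M > (0 : ℝ), ∀ i, a n i * ((i : ℝ) + 1) ≤ M * a m i := by
  obtain ⟨m, -, C, hC, hm⟩ := hG2 n
  obtain ⟨B, hB⟩ := (h m).bddAbove_range
  refine ⟨m, C * max B 1, by positivity, fun i => ?_⟩
  have hBi : a m i * ((i : ℝ) + 1) ≤ max B 1 := by
    have := hB ⟨i, rfl⟩
    simp only [pow_one] at this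
    exact this.trans (le_max_left _ _)
  calc a n i * ((i : ℝ) + 1) ≤ C * a m i ^ 2 * ((i : ℝ) + 1) :=
        mul_le_mul_of_nonneg_right (hm i) (by positivity)
    _ = C * a m i * (a m i * ((i : ℝ) + 1)) := by ring
    _ ≤ C * a m i * max B 1 := mul_le_mul_of_nonneg_left hBi (mul_nonneg hC.le (h0 m i))
    _ = C * max B 1 * a m i := by ring

theorem mul_norm_icesaro_le {a : ℕ → ℕ → ℝ} (h0 : ∀ n i, 0 ≤ a n i) (hG1 : G11 a)
    {n m : ℕ} {M : ℝ} (hM : 0 < M)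
    (h : ∀ i : ℕ, a n i * ((i : ℝ) + 1) ≤ M * a m i) (y : ℕ → ℂ) (i : ℕ) :
    a n i * ‖icesaro y i‖ ≤ M * (a m i * ‖y i‖) + M * (a m (i - 1) * ‖y (i - 1)‖) := by
  have htri : ‖icesaro y i‖ ≤ ((i : ℝ) + 1) * ‖y i‖ + (i : ℝ) * ‖y (i - 1)‖ := by
    refine (norm_sub_le _ _).trans_eq ?_
    have h1 : ‖(i : ℂ) + 1‖ = (i : ℝ) + 1 := by
      exact_mod_cast Complex.norm_natCast (i + 1)
    rw [norm_mul, norm_mul, h1, Complex.norm_natCast]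
  have hshift : a n i * (i : ℝ) ≤ M * a m (i - 1) := by
    rcases i with _ | i
    · simpa using mul_nonneg hM.le (h0 m 0)
    · rw [Nat.add_sub_cancel]
      push_cast
      exact (mul_le_mul_of_nonneg_right (hG1 n i).2 (by positivity)).trans (h i)
  calc a n i * ‖icesaro y i‖
      ≤ a n i * (((i : ℝ) + 1) * ‖y i‖ + (i : ℝ) * ‖y (i - 1)‖) :=
        mul_le_mul_of_nonneg_left htri (h0 n i)
    _ = a n i * ((i : ℝ) + 1) * ‖y i‖ + a n i * (i : ℝ) * ‖y (i - 1)‖ := by ring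
    _ ≤ M * a m i * ‖y i‖ + M * a m (i - 1) * ‖y (i - 1)‖ :=
        add_le_add (mul_le_mul_of_nonneg_right (h i) (norm_nonneg _))
          (mul_le_mul_of_nonneg_right hshift (norm_nonneg _))
    _ = _ := by ring

theorem DecaysPow.inLambda0_icesaro {a : ℕ → ℕ → ℝ} (h0 : ∀ n i, 0 ≤ a n i) (hG1 : G11 a)
    (hG2 : G12 a) (h : DecaysPow a 1) {y : ℕ → ℂ} (hy : inLambda0 a y) :
    inLambda0 a (icesaro y) := by
  intro n
  obtain ⟨m, M, hM, hb⟩ := h.exists_mul_le h0 hG2 n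
  have hlim := ((hy m).const_mul M).add
    (((hy m).comp (tendsto_sub_atTop_nat 1)).const_mul M)
  rw [mul_zero, add_zero] at hlim
  exact squeeze_zero (fun i => mul_nonneg (h0 n i) (norm_nonneg _))
    (mul_norm_icesaro_le h0 hG1 hM hb y) hlim

theorem DecaysPow.pnorm_icesaro_le {a : ℕ → ℕ → ℝ} (h0 : ∀ n i, 0 ≤ a n i) (hG1 : G11 a)
    (hG2 : G12 a) (h : DecaysPow a 1) (n : ℕ) :
    ∃ m : ℕ, ∃ M > (0 : ℝ),
      ∀ y : ℕ → ℂ, inLambda0 a y → pnorm a n (icesaro y) ≤ M * pnorm a m y := by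
  obtain ⟨m, M, hM, hb⟩ := h.exists_mul_le h0 hG2 n
  refine ⟨m, 2 * M, by positivity, fun y hy => ciSup_le fun i => ?_⟩
  have h1 := mul_le_mul_of_nonneg_left (hy.le_pnorm m i) hM.le
  have h2 := mul_le_mul_of_nonneg_left (hy.le_pnorm m (i - 1)) hM.le
  linarith [mul_norm_icesaro_le h0 hG1 hM hb y i]

theorem DecaysPow.exists_eigenvector {a : ℕ → ℕ → ℝ} (h0 : ∀ n i, 0 ≤ a n i) (hG2 : G12 a)
    (h : DecaysPow a 1) {s : ℕ} (hs : 1 ≤ s) :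
    ∃ x : ℕ → ℂ, inLambda0 a x ∧ x ≠ 0 ∧ ∀ i, cesaro x i = (1 / (s : ℂ)) * x i := by
  obtain ⟨k, rfl⟩ := Nat.exists_eq_add_of_le' hs
  refine ⟨fun i => (i.choose k : ℂ), (h.all h0 hG2 k).inLambda0_choose h0, fun hzero => ?_,
    cesaro_choose k⟩
  simpa using congrFun hzero k

/-- For a `G₁`-space `λ₀(A)` the following are equivalent: (1) `0 ∉ σ(C)`;
(2) `1/2` is an eigenvalue of `C`; (3) some `1/s`, `s ≥ 2`, is an eigenvalue of `C`;
(4) every `1/s`, `s ≥ 1`, is an eigenvalue of `C`. -/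
theorem stmt7 (a : ℕ → ℕ → ℝ) (hK : KotheMatrix a) (hG1 : G11 a) (hG2 : G12 a)
    (hvanish : ∀ n, Tendsto (fun i => a n i) atTop (𝓝 0)) :
    (((∀ y : ℕ → ℂ, inLambda0 a y → inLambda0 a (icesaro y)) ∧
        ∀ n : ℕ, ∃ m : ℕ, ∃ M > (0 : ℝ),
          ∀ y : ℕ → ℂ, inLambda0 a y → pnorm a n (icesaro y) ≤ M * pnorm a m y) ↔
      (∃ x : ℕ → ℂ, inLambda0 a x ∧ x ≠ 0 ∧ ∀ i, cesaro x i = (1 / 2 : ℂ) * x i)) ∧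
    ((∃ x : ℕ → ℂ, inLambda0 a x ∧ x ≠ 0 ∧ ∀ i, cesaro x i = (1 / 2 : ℂ) * x i) ↔
      (∃ s : ℕ, 2 ≤ s ∧
        ∃ x : ℕ → ℂ, inLambda0 a x ∧ x ≠ 0 ∧ ∀ i, cesaro x i = (1 / (s : ℂ)) * x i)) ∧
    ((∃ s : ℕ, 2 ≤ s ∧
        ∃ x : ℕ → ℂ, inLambda0 a x ∧ x ≠ 0 ∧ ∀ i, cesaro x i = (1 / (s : ℂ)) * x i) ↔
      (∀ s : ℕ, 1 ≤ s →
        ∃ x : ℕ → ℂ, inLambda0 a x ∧ x ≠ 0 ∧ ∀ i, cesaro x i = (1 / (s : ℂ)) * x i)) := by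
  have h0 : ∀ n i, 0 ≤ a n i := fun n i => (hK.1 n i).1
  have decays_of_eigenvalue : (∃ s : ℕ, 2 ≤ s ∧ ∃ x : ℕ → ℂ, inLambda0 a x ∧ x ≠ 0 ∧
      ∀ i, cesaro x i = (1 / (s : ℂ)) * x i) → DecaysPow a 1 := by
    rintro ⟨s, hs, x, hx, hx0, hev⟩
    obtain ⟨k, rfl⟩ := Nat.exists_eq_add_of_le' hs
    exact DecaysPow.of_eigenvector h0 hvanish hx hx0 hev
  have half_of_decays : DecaysPow a 1 → ∃ x : ℕ → ℂ, inLambda0 a x ∧ x ≠ 0 ∧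
      ∀ i, cesaro x i = (1 / 2 : ℂ) * x i := fun h => by
    simpa using h.exists_eigenvector h0 hG2 one_le_two
  have exists_of_half : (∃ x : ℕ → ℂ, inLambda0 a x ∧ x ≠ 0 ∧
      ∀ i, cesaro x i = (1 / 2 : ℂ) * x i) → ∃ s : ℕ, 2 ≤ s ∧ ∃ x : ℕ → ℂ,
      inLambda0 a x ∧ x ≠ 0 ∧ ∀ i, cesaro x i = (1 / (s : ℂ)) * x i :=
    fun h => ⟨2, le_rfl, by exact_mod_cast h⟩
  refine ⟨⟨fun h => half_of_decays (.of_icesaro h0 hvanish h.1 h.2), fun h => ?_⟩,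
    ⟨exists_of_half, fun h => half_of_decays (decays_of_eigenvalue h)⟩,
    ⟨fun h s hs => (decays_of_eigenvalue h).exists_eigenvector h0 hG2 hs,
      fun h => ⟨2, le_rfl, h 2 one_le_two⟩⟩⟩
  have hdec := decays_of_eigenvalue (exists_of_half h)
  exact ⟨fun y => hdec.inLambda0_icesaro h0 hG1 hG2, hdec.pnorm_icesaro_le h0 hG1 hG2⟩
end
end

section
/- Let A be a G₁-matrix with lim_{i→∞} a_n(i) = 0 for every n, satisfying the Grothendieck–Pietsch condition: for every n there exists m > n with Σ_i a_n(i)/a_m(i) < ∞ (i.e. λ₀(A) is nuclear). Then for every λ ∈ ℂ with λ ≠ 0 and λ ∉ {1/k : k ∈ ℕ}, the map x ↦ C x − λ·x is a bijection of λ₀(A) onto itself, and for every n there exist m and M > 0 such that p_n(x) ≤ M·p_m(C x − λ·x) for all x ∈ λ₀(A). (Hence the spectrum of C on λ₀(A) equals Σ = {1/k : k ∈ ℕ}.) -/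
open Filter Finset Topology

noncomputable section

section Weights

variable {a : ℕ → ℕ → ℝ}

theorem G11.antitone (hG1 : G11 a) (n : ℕ) : Antitone (a n) :=
  antitone_nat_of_succ_le fun i => (hG1 n i).2

theorem G11.pos (hG1 : G11 a) (n i : ℕ) : 0 < a n i :=
  (hG1 n i).1.trans_le (hG1 n i).2

/-- In a nuclear echelon space with decreasing weights every weight is summable. -/
theorem summable_weight (hG1 : G11 a)
    (hnuc : ∀ n : ℕ, ∃ m > n, Summable (fun i => a n i / a m i)) (n : ℕ) : Summable (a n) := by
  obtain ⟨m, -, hs⟩ := hnuc n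
  refine Summable.of_nonneg_of_le (fun i => (hG1.pos n i).le) (fun i => ?_) (hs.mul_left (a m 0))
  have hm := hG1.pos m i
  calc a n i = a m i * (a n i / a m i) := by field_simp
    _ ≤ a m 0 * (a n i / a m i) :=
      mul_le_mul_of_nonneg_right (hG1.antitone m (Nat.zero_le i))
        (div_nonneg (hG1.pos n i).le hm.le)

/-- Decreasing summable weights satisfy `a_n(i) = O(1 / (i + 1))`. -/
theorem succ_mul_weight_le_tsum (hG1 : G11 a) {n : ℕ} (hs : Summable (a n)) (i : ℕ) :
    ((i : ℝ) + 1) * a n i ≤ ∑' j, a n j := by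
  have hcard : ∑ _j ∈ range (i + 1), a n i = ((i : ℝ) + 1) * a n i := by simp
  rw [← hcard]
  calc ∑ _j ∈ range (i + 1), a n i ≤ ∑ j ∈ range (i + 1), a n j :=
        sum_le_sum fun j hj => hG1.antitone n (by simpa [Nat.lt_succ_iff] using hj)
    _ ≤ ∑' j, a n j := hs.sum_le_tsum _ fun j _ => (hG1.pos n j).le

/-- In a nuclear `G₁`-space, diagonal multiplication by any power of the index is continuous. -/
theorem exists_succ_pow_mul_weight_le (hG1 : G11 a) (hG2 : G12 a)
    (hsum : ∀ n, Summable (a n)) (n p : ℕ) :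
    ∃ k, ∃ D > (0 : ℝ), ∀ i : ℕ, ((i : ℝ) + 1) ^ p * a n i ≤ D * a k i := by
  induction p with
  | zero => exact ⟨n, 1, one_pos, fun i => by simp⟩
  | succ p ih =>
    obtain ⟨k, D, hD, h⟩ := ih
    obtain ⟨m, -, C, hC, hm⟩ := hG2 k
    have hT : 0 < ∑' j, a m j := (hsum m).tsum_pos (fun j => (hG1.pos m j).le) 0 (hG1.pos m 0)
    refine ⟨m, D * C * ∑' j, a m j, by positivity, fun i => ?_⟩
    have hmi := hG1.pos m i
    calc ((i : ℝ) + 1) ^ (p + 1) * a n i = ((i : ℝ) + 1) * (((i : ℝ) + 1) ^ p * a n i) := by ring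
      _ ≤ ((i : ℝ) + 1) * (D * (C * a m i ^ 2)) := by
        refine mul_le_mul_of_nonneg_left ?_ (by positivity)
        exact (h i).trans (mul_le_mul_of_nonneg_left (hm i) hD.le)
      _ = D * C * (((i : ℝ) + 1) * a m i) * a m i := by ring
      _ ≤ D * C * (∑' j, a m j) * a m i := by
        gcongr
        exact succ_mul_weight_le_tsum hG1 (hsum m) i

theorem weight_mul_norm_le_pnorm {y : ℕ → ℂ} (hy : inLambda0 a y) (n i : ℕ) :
    a n i * ‖y i‖ ≤ pnorm a n y :=
  le_ciSup (hy n).bddAbove_range i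

theorem pnorm_nonneg (hG1 : G11 a) (n : ℕ) (y : ℕ → ℂ) : 0 ≤ pnorm a n y :=
  Real.iSup_nonneg fun i => mul_nonneg (hG1.pos n i).le (norm_nonneg _)

/-- Sequences dominated by a power of the index times the partial sums of `‖y‖` decay in every
seminorm, at a rate controlled by a seminorm of `y`. -/
theorem exists_weight_mul_norm_le_div (hG1 : G11 a) (hG2 : G12 a)
    (hsum : ∀ n, Summable (a n)) {B : ℝ} (hB : 0 < B) (p n : ℕ) :
    ∃ k, ∃ M > (0 : ℝ), ∀ y z : ℕ → ℂ, inLambda0 a y →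
      (∀ i : ℕ, ‖z i‖ ≤ B * ((i : ℝ) + 1) ^ p * ∑ j ∈ range (i + 1), ‖y j‖) →
      ∀ i : ℕ, a n i * ‖z i‖ ≤ M * pnorm a k y / ((i : ℝ) + 1) := by
  obtain ⟨k, D, hD, h⟩ := exists_succ_pow_mul_weight_le hG1 hG2 hsum n (p + 2)
  refine ⟨k, B * D, by positivity, fun y z hy hz i => ?_⟩
  have hn := hG1.pos n i
  have hk : a k i * ∑ j ∈ range (i + 1), ‖y j‖ ≤ ((i : ℝ) + 1) * pnorm a k y := by
    rw [mul_sum]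
    refine (sum_le_card_nsmul _ _ (pnorm a k y) fun j hj => ?_).trans_eq (by simp)
    refine le_trans ?_ (weight_mul_norm_le_pnorm hy k j)
    exact mul_le_mul_of_nonneg_right
      (hG1.antitone k (by simpa [Nat.lt_succ_iff] using hj)) (norm_nonneg _)
  have hT : 0 ≤ ∑ j ∈ range (i + 1), ‖y j‖ := sum_nonneg fun j _ => norm_nonneg _
  rw [le_div_iff₀ (by positivity)]
  refine le_of_mul_le_mul_right ?_ (show (0 : ℝ) < (i : ℝ) + 1 by positivity)
  calc a n i * ‖z i‖ * ((i : ℝ) + 1) * ((i : ℝ) + 1)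
      ≤ a n i * (B * ((i : ℝ) + 1) ^ p * ∑ j ∈ range (i + 1), ‖y j‖) * ((i : ℝ) + 1) *
          ((i : ℝ) + 1) := by
        gcongr
        exact hz i
    _ = B * (((i : ℝ) + 1) ^ (p + 2) * a n i) * ∑ j ∈ range (i + 1), ‖y j‖ := by ring
    _ ≤ B * (D * a k i) * ∑ j ∈ range (i + 1), ‖y j‖ :=
        mul_le_mul_of_nonneg_right (mul_le_mul_of_nonneg_left (h i) hB.le) hT
    _ = B * D * (a k i * ∑ j ∈ range (i + 1), ‖y j‖) := by ring
    _ ≤ B * D * (((i : ℝ) + 1) * pnorm a k y) := by gcongr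
    _ = B * D * pnorm a k y * ((i : ℝ) + 1) := by ring

theorem inLambda0_of_norm_le (hG1 : G11 a) (hG2 : G12 a) (hsum : ∀ n, Summable (a n))
    {B : ℝ} (hB : 0 < B) (p : ℕ) {y z : ℕ → ℂ} (hy : inLambda0 a y)
    (hz : ∀ i : ℕ, ‖z i‖ ≤ B * ((i : ℝ) + 1) ^ p * ∑ j ∈ range (i + 1), ‖y j‖) :
    inLambda0 a z := by
  intro n
  obtain ⟨k, M, -, h⟩ := exists_weight_mul_norm_le_div hG1 hG2 hsum hB p n
  refine squeeze_zero (fun i => mul_nonneg (hG1.pos n i).le (norm_nonneg _)) (h y z hy hz) ?_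
  simpa [div_eq_mul_inv] using
    (tendsto_one_div_add_atTop_nhds_zero_nat (𝕜 := ℝ)).const_mul (M * pnorm a k y)

theorem pnorm_le_of_weight_mul_norm_le_div {n : ℕ} {R : ℝ} (hR : 0 ≤ R) {z : ℕ → ℂ}
    (h : ∀ i : ℕ, a n i * ‖z i‖ ≤ R / ((i : ℝ) + 1)) : pnorm a n z ≤ R :=
  ciSup_le fun i => (h i).trans (div_le_self hR (by simp))

theorem inLambda0.sub_const_mul (hG1 : G11 a) {x y : ℕ → ℂ} (hx : inLambda0 a x)
    (hy : inLambda0 a y) (l : ℂ) : inLambda0 a (fun i => x i - l * y i) := by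
  intro n
  have hlim := (hx n).add ((hy n).const_mul ‖l‖)
  simp only [mul_zero, add_zero] at hlim
  refine squeeze_zero (fun i => mul_nonneg (hG1.pos n i).le (norm_nonneg _)) (fun i => ?_) hlim
  calc a n i * ‖x i - l * y i‖ ≤ a n i * (‖x i‖ + ‖l‖ * ‖y i‖) := by
        refine mul_le_mul_of_nonneg_left ?_ (hG1.pos n i).le
        simpa using norm_sub_le (x i) (l * y i)
    _ = a n i * ‖x i‖ + ‖l‖ * (a n i * ‖y i‖) := by ring

theorem inLambda0.cesaro (hG1 : G11 a) (hG2 : G12 a) (hsum : ∀ n, Summable (a n))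
    {x : ℕ → ℂ} (hx : inLambda0 a x) : inLambda0 a (cesaro x) := by
  refine inLambda0_of_norm_le hG1 hG2 hsum one_pos 0 hx fun i => ?_
  have hi : ‖(i : ℂ) + 1‖ = (i : ℝ) + 1 := by
    exact_mod_cast Complex.norm_natCast (i + 1)
  rw [_root_.cesaro, norm_div, hi, pow_zero, mul_one, one_mul]
  exact (div_le_self (norm_nonneg _) (by simp)).trans (norm_sum_le _ _)

end Weights

section Resolvent

variable {l : ℂ}

theorem one_div_succ_sub_ne_zero (hl : ∀ k : ℕ, 1 ≤ k → l ≠ 1 / (k : ℂ)) (i : ℕ) :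
    1 / ((i : ℂ) + 1) - l ≠ 0 := by
  have := hl (i + 1) (by simp)
  push_cast at this
  exact sub_ne_zero.2 this.symm

theorem exists_norm_inv_le (hl0 : l ≠ 0) :
    ∃ K : ℕ, 0 < K ∧ ∀ i : ℕ, ‖(1 / ((i : ℂ) + 1) - l)⁻¹‖ ≤ K := by
  have h1 : Tendsto (fun i : ℕ => (1 / ((i : ℂ) + 1) - l)⁻¹) atTop (𝓝 (0 - l)⁻¹) :=
    ((tendsto_one_div_add_atTop_nhds_zero_nat (𝕜 := ℂ)).sub_const l).inv₀ (by simpa using hl0)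
  obtain ⟨R, hR⟩ := h1.norm.bddAbove_range
  obtain ⟨K, hK⟩ := exists_nat_ge R
  refine ⟨K + 1, K.succ_pos, fun i => (hR ⟨i, rfl⟩).trans (hK.trans ?_)⟩
  push_cast
  linarith

/-- The equation `(C x - l x)_i = y_i`, solved for `x_i` in terms of the preceding entries. -/
theorem cesaro_sub_mul_eq_iff (hl : ∀ k : ℕ, 1 ≤ k → l ≠ 1 / (k : ℂ)) (x : ℕ → ℂ) (i : ℕ)
    (w : ℂ) :
    cesaro x i - l * x i = w ↔
      x i = (1 / ((i : ℂ) + 1) - l)⁻¹ * (w - (∑ j ∈ range i, x j) / ((i : ℂ) + 1)) := by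
  have hw := one_div_succ_sub_ne_zero hl i
  rw [eq_inv_mul_iff_mul_eq₀ hw, cesaro, sum_range_succ, eq_sub_iff_add_eq]
  constructor <;> intro h <;> rw [← h] <;> ring

theorem exists_cesaro_sub_mul_eq (hl : ∀ k : ℕ, 1 ≤ k → l ≠ 1 / (k : ℂ)) (y : ℕ → ℂ) :
    ∃ x : ℕ → ℂ, (fun i => cesaro x i - l * x i) = y := by
  let f : ℕ → ℂ → ℂ := fun i s => (1 / ((i : ℂ) + 1) - l)⁻¹ * (y i - s / ((i : ℂ) + 1))
  let S : ℕ → ℂ := fun i => Nat.rec 0 (fun j s => s + f j s) i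
  have hS : ∀ i, ∑ j ∈ range i, f j (S j) = S i := by
    intro i
    induction i with
    | zero => rfl
    | succ i ih => rw [sum_range_succ, ih]
  refine ⟨fun i => f i (S i), funext fun i => ?_⟩
  rw [cesaro_sub_mul_eq_iff hl, hS]

theorem one_add_div_mul_pow_le (K i : ℕ) :
    (1 + (K : ℝ) / ((i : ℝ) + 1)) * ((i : ℝ) + 1) ^ K ≤ ((i : ℝ) + 2) ^ K := by
  have hi : (0 : ℝ) < (i : ℝ) + 1 := by positivity
  have hb : 1 + (K : ℝ) / ((i : ℝ) + 1) ≤ (1 + 1 / ((i : ℝ) + 1)) ^ K := by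
    have h := one_add_mul_le_pow (a := 1 / ((i : ℝ) + 1))
      (le_trans (by norm_num) (one_div_pos.2 hi).le) K
    rwa [mul_one_div] at h
  calc (1 + (K : ℝ) / ((i : ℝ) + 1)) * ((i : ℝ) + 1) ^ K
      ≤ (1 + 1 / ((i : ℝ) + 1)) ^ K * ((i : ℝ) + 1) ^ K := by gcongr
    _ = ((i : ℝ) + 2) ^ K := by
      rw [← mul_pow]
      congr 1
      field_simp
      ring

theorem norm_sum_range_le (hl : ∀ k : ℕ, 1 ≤ k → l ≠ 1 / (k : ℂ)) {K : ℕ}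
    (hK : ∀ i : ℕ, ‖(1 / ((i : ℂ) + 1) - l)⁻¹‖ ≤ K) (x : ℕ → ℂ) (i : ℕ) :
    ‖∑ j ∈ range i, x j‖ ≤
      K * ((i : ℝ) + 1) ^ K * ∑ j ∈ range i, ‖cesaro x j - l * x j‖ := by
  induction i with
  | zero => simp
  | succ i ih =>
    set T := ∑ j ∈ range i, ‖cesaro x j - l * x j‖
    have hT : 0 ≤ T := sum_nonneg fun j _ => norm_nonneg _
    set w := cesaro x i - l * x i with hw
    have hi : ‖(i : ℂ) + 1‖ = (i : ℝ) + 1 := by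
      exact_mod_cast Complex.norm_natCast (i + 1)
    have hx : ‖x i‖ ≤ K * (‖w‖ + ‖∑ j ∈ range i, x j‖ / ((i : ℝ) + 1)) := by
      rw [(cesaro_sub_mul_eq_iff hl x i w).1 hw.symm, norm_mul]
      gcongr
      · exact hK i
      · refine (norm_sub_le _ _).trans_eq ?_
        rw [norm_div, hi]
    have hpow : (1 : ℝ) ≤ ((i : ℝ) + 2) ^ K :=
      one_le_pow₀ (by linarith [(Nat.cast_nonneg i : (0 : ℝ) ≤ i)])
    rw [sum_range_succ, sum_range_succ]
    calc ‖∑ j ∈ range i, x j + x i‖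
        ≤ ‖∑ j ∈ range i, x j‖ + K * (‖w‖ + ‖∑ j ∈ range i, x j‖ / ((i : ℝ) + 1)) :=
          (norm_add_le _ _).trans (by gcongr)
      _ = (1 + (K : ℝ) / ((i : ℝ) + 1)) * ‖∑ j ∈ range i, x j‖ + K * ‖w‖ := by ring
      _ ≤ (1 + (K : ℝ) / ((i : ℝ) + 1)) * (K * ((i : ℝ) + 1) ^ K * T) + K * ‖w‖ := by gcongr
      _ = K * T * ((1 + (K : ℝ) / ((i : ℝ) + 1)) * ((i : ℝ) + 1) ^ K) + K * ‖w‖ * 1 := by ring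
      _ ≤ K * T * ((i : ℝ) + 2) ^ K + K * ‖w‖ * ((i : ℝ) + 2) ^ K := by
          gcongr
          exact one_add_div_mul_pow_le K i
      _ = K * (((i + 1 : ℕ) : ℝ) + 1) ^ K * (T + ‖w‖) := by
          push_cast
          ring

theorem norm_le_of_resolvent (hl : ∀ k : ℕ, 1 ≤ k → l ≠ 1 / (k : ℂ)) {K : ℕ}
    (hK : ∀ i : ℕ, ‖(1 / ((i : ℂ) + 1) - l)⁻¹‖ ≤ K) (x : ℕ → ℂ) (i : ℕ) :
    ‖x i‖ ≤ 2 * K * 2 ^ K * ((i : ℝ) + 1) ^ K *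
      ∑ j ∈ range (i + 1), ‖cesaro x j - l * x j‖ := by
  have h0 := norm_sum_range_le hl hK x i
  have h1 := norm_sum_range_le hl hK x (i + 1)
  have hx : x i = ∑ j ∈ range (i + 1), x j - ∑ j ∈ range i, x j := by
    rw [sum_range_succ]
    ring
  set T := ∑ j ∈ range (i + 1), ‖cesaro x j - l * x j‖
  have hT : 0 ≤ T := sum_nonneg fun j _ => norm_nonneg _
  have hle : ∑ j ∈ range i, ‖cesaro x j - l * x j‖ ≤ T :=
    sum_le_sum_of_subset_of_nonneg (range_mono (Nat.le_succ i)) fun j _ _ => norm_nonneg _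
  have hi : (0 : ℝ) ≤ i := Nat.cast_nonneg i
  push_cast at h1
  calc ‖x i‖ ≤ ‖∑ j ∈ range (i + 1), x j‖ + ‖∑ j ∈ range i, x j‖ := by
        rw [hx]
        exact norm_sub_le _ _
    _ ≤ K * (2 * ((i : ℝ) + 1)) ^ K * T + K * (2 * ((i : ℝ) + 1)) ^ K * T := by
        refine add_le_add (h1.trans ?_) (h0.trans ?_)
        · gcongr
          linarith
        · gcongr
          linarith
    _ = 2 * K * 2 ^ K * ((i : ℝ) + 1) ^ K * T := by
        rw [mul_pow]
        ring

end Resolvent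

/-- For a nuclear `G₁`-space `λ₀(A)` and every `λ ∉ Σ₀ = {0} ∪ {1/k}`, the map
`x ↦ C x − λ·x` is a bijection of `λ₀(A)` onto itself with continuous inverse. -/
theorem stmt11 (a : ℕ → ℕ → ℝ) (hK : KotheMatrix a) (hG1 : G11 a) (hG2 : G12 a)
    (hvanish : ∀ n, Tendsto (fun i => a n i) atTop (𝓝 0))
    (hnuc : ∀ n : ℕ, ∃ m > n, Summable (fun i => a n i / a m i)) :
    ∀ l : ℂ, l ≠ 0 → (∀ k : ℕ, 1 ≤ k → l ≠ 1 / (k : ℂ)) →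
      Set.BijOn (fun x : ℕ → ℂ => fun i => cesaro x i - l * x i)
          {x | inLambda0 a x} {x | inLambda0 a x} ∧
        ∀ n : ℕ, ∃ m : ℕ, ∃ M > (0 : ℝ), ∀ x : ℕ → ℂ, inLambda0 a x →
          pnorm a n x ≤ M * pnorm a m (fun i => cesaro x i - l * x i) := by
  intro l hl0 hl
  have hsum := summable_weight hG1 hnuc
  obtain ⟨K, hKpos, hKle⟩ := exists_norm_inv_le hl0
  have hB : (0 : ℝ) < 2 * K * 2 ^ K := by positivity
  have hbound := norm_le_of_resolvent hl hKle
  refine ⟨⟨fun x hx => (hx.cesaro hG1 hG2 hsum).sub_const_mul hG1 hx l, ?_, ?_⟩, fun n => ?_⟩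
  · intro x _ x' _ hxx'
    funext i
    have hzero : ∀ j, cesaro (x - x') j - l * (x - x') j = 0 := by
      intro j
      have hj := congrFun hxx' j
      simp only [cesaro] at hj
      simp only [cesaro, Pi.sub_apply, sum_sub_distrib]
      linear_combination hj
    have hi := hbound (x - x') i
    simp only [hzero, norm_zero, sum_const_zero, mul_zero] at hi
    exact sub_eq_zero.1 (norm_le_zero_iff.1 hi)
  · intro y hy
    obtain ⟨x, rfl⟩ := exists_cesaro_sub_mul_eq hl y
    exact ⟨x, inLambda0_of_norm_le hG1 hG2 hsum hB K hy (hbound x), rfl⟩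
  · obtain ⟨k, M, hM, h⟩ := exists_weight_mul_norm_le_div hG1 hG2 hsum hB K n
    refine ⟨k, M, hM, fun x hx => ?_⟩
    exact pnorm_le_of_weight_mul_norm_le_div (mul_nonneg hM.le (pnorm_nonneg hG1 k _))
      (h _ x ((hx.cesaro hG1 hG2 hsum).sub_const_mul hG1 hx l) (hbound x))
end
end
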